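/- Let H̃>0, β>0 and η∈(0,β/2). Then there exists ζ>0 depending only on d, β, η and H̃ such that for every φ∈C^{2,1}([0,1]^d,ℝ) with ‖φ‖_{C^{2,1}([0,1]^d,ℝ)} ≤ H̃ that is not (β/2−η)-strongly convex on [0,1]^d, one has P^{(β/2)}(φ) ≥ ζ. -/

import Mathlib

open MeasureTheory ProbabilityTheory
open scoped ENNReal Classical

noncomputable section

abbrev E (d : ℕ) := EuclideanSpace ℝ (Fin d)

def cube (d : ℕ) : Set (E d) := {x | ∀ i, x i ∈ Set.Icc (0:ℝ) 1}

def lam (d : ℕ) : Measure (E d) := volume.restrict (cube d)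

def KL {d : ℕ} (ν μ : Measure (E d)) : ℝ := ∫ x, Real.log ((ν.rnDeriv μ) x).toReal ∂ν

def JS {d : ℕ} (μ ν : Measure (E d)) : ℝ :=
  (1/2) * (KL ν ((2:ℝ≥0∞)⁻¹ • (μ + ν)) + KL μ ((2:ℝ≥0∞)⁻¹ • (μ + ν)))

def ganLoss {d : ℕ} (μstar : Measure (E d)) (G : E d → E d) (D : E d → ℝ) : ℝ :=
  (1/2) * ((∫ y, Real.log (D y) ∂μstar) + ∫ z, Real.log (1 - D (G z)) ∂(lam d))

def hessW {d : ℕ} (φ : E d → ℝ) (x : E d) : E d →L[ℝ] E d →L[ℝ] ℝ :=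
  fderivWithin ℝ (fun y => fderivWithin ℝ φ (cube d) y) (cube d) x

def gradW {d : ℕ} (φ : E d → ℝ) (x : E d) : E d :=
  (InnerProductSpace.toDual ℝ (E d)).symm (fderivWithin ℝ φ (cube d) x)

def hessMat {d : ℕ} (φ : E d → ℝ) (x : E d) : Matrix (Fin d) (Fin d) ℝ :=
  fun i j => hessW φ x (EuclideanSpace.single i 1) (EuclideanSpace.single j 1)

def C2norm {d : ℕ} (φ : E d → ℝ) : ℝ :=
  ⨆ k : Fin 3, ⨆ x : cube d, ‖iteratedFDerivWithin ℝ (k : ℕ) φ (cube d) (x : E d)‖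

def C21norm {d : ℕ} (φ : E d → ℝ) : ℝ :=
  C2norm φ + ⨆ p : cube d × cube d,
    ‖iteratedFDerivWithin ℝ 2 φ (cube d) (p.1 : E d) - iteratedFDerivWithin ℝ 2 φ (cube d) (p.2 : E d)‖
      / ‖(p.1 : E d) - (p.2 : E d)‖

def Pen {d : ℕ} (κ : ℝ) (φ : E d → ℝ) : ℝ :=
  ∫ u, max 0 (φ ((2:ℝ)⁻¹ • (u.1 + u.2)) - (φ u.1 + φ u.2)/2 + (κ/8) * ‖u.1 - u.2‖^2)
    ∂((volume.restrict (cube d)).prod (volume.restrict (cube d)))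

lemma cube_convex (d : ℕ) : Convex ℝ (cube d) := by
  intro x hx y hy a b ha hb hab i
  have h := (convex_Icc (0:ℝ) 1) (hx i) (hy i) ha hb hab
  simpa using h

lemma cube_compact (d : ℕ) : IsCompact (cube d) := by
  have h : IsCompact (Set.pi Set.univ (fun _ : Fin d => Set.Icc (0:ℝ) 1)) :=
    isCompact_univ_pi (fun _ => isCompact_Icc)
  have h2 := h.image (PiLp.continuous_toLp 2 (fun _ : Fin d => ℝ))
  convert h2 using 1
  ext x
  constructor
  · intro hx
    exact ⟨fun i => x i, fun i _ => hx i, rfl⟩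
  · rintro ⟨y, hy, rfl⟩ i
    exact hy i (Set.mem_univ i)

def cubeC (d : ℕ) : E d := WithLp.toLp 2 (fun _ => (1/2 : ℝ))

lemma cube_ball {d : ℕ} {z p : E d} {s : ℝ} (hz : z ∈ cube d) (hs1 : s ≤ 1)
    (hp : ‖p - (z + s • (cubeC d - z))‖ ≤ s / 2) : p ∈ cube d := by
  intro i
  have h1 := (PiLp.norm_apply_le (p - (z + s • (cubeC d - z))) i).trans hp
  have h2 : (p - (z + s • (cubeC d - z))) i = p i - (z i + s * (1/2 - z i)) := by
    simp [cubeC]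
  rw [h2, Real.norm_eq_abs, abs_le] at h1
  obtain ⟨h3, h4⟩ := hz i
  constructor
  · nlinarith [mul_nonneg (sub_nonneg.2 hs1) h3]
  · nlinarith [mul_nonneg (sub_nonneg.2 hs1) (sub_nonneg.2 h4)]

lemma cubeC_mem (d : ℕ) : cubeC d ∈ cube d := by
  intro i
  simp [cubeC]
  norm_num

lemma cube_unique (d : ℕ) : UniqueDiffOn ℝ (cube d) := by
  refine uniqueDiffOn_convex (cube_convex d) ⟨cubeC d, ?_⟩
  rw [mem_interior_iff_mem_nhds]
  refine Filter.mem_of_superset (Metric.closedBall_mem_nhds (cubeC d) (ε := 1/2) (by norm_num)) ?_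
  intro p hp
  refine cube_ball (cubeC_mem d) le_rfl ?_
  rw [Metric.mem_closedBall, dist_eq_norm] at hp
  simpa using hp

lemma line_mem {d : ℕ} {x y : E d} (hx : x ∈ cube d) (hy : y ∈ cube d) {t : ℝ}
    (ht : t ∈ Set.Icc (0:ℝ) 1) : x + t • (y - x) ∈ cube d :=
  (cube_convex d).add_smul_sub_mem hx hy ht

lemma line_deriv {d : ℕ} {F : Type*} [NormedAddCommGroup F] [NormedSpace ℝ F] {f : E d → F}
    (hf : DifferentiableOn ℝ f (cube d))
    {x y : E d} (hx : x ∈ cube d) (hy : y ∈ cube d) {t : ℝ}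
    (ht : t ∈ Set.Icc (0:ℝ) 1) :
    HasDerivWithinAt (fun t : ℝ => f (x + t • (y - x)))
      (fderivWithin ℝ f (cube d) (x + t • (y - x)) (y - x)) (Set.Icc 0 1) t := by
  have h1 := (hf _ (line_mem hx hy ht)).hasFDerivWithinAt
  have h2 : HasDerivWithinAt (fun t : ℝ => x + t • (y - x)) (y - x) (Set.Icc 0 1) t := by
    have := ((hasDerivAt_id t).smul_const (y - x)).const_add x
    simpa using this.hasDerivWithinAt
  exact h1.comp_hasDerivWithinAt t h2 (fun t ht => line_mem hx hy ht)

lemma line_data {d : ℕ} {φ : E d → ℝ} (hφ : ContDiffOn ℝ 2 φ (cube d))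
    {x y : E d} (hx : x ∈ cube d) (hy : y ∈ cube d) (K : ℝ) :
    ContinuousOn (fun t : ℝ => φ (x + t • (y - x)) - K / 2 * t ^ 2) (Set.Icc 0 1) ∧
    (∀ t ∈ interior (Set.Icc (0:ℝ) 1),
      HasDerivWithinAt (fun t : ℝ => φ (x + t • (y - x)) - K / 2 * t ^ 2)
      (fderivWithin ℝ φ (cube d) (x + t • (y - x)) (y - x) - K * t)
        (interior (Set.Icc (0:ℝ) 1)) t) ∧
    (∀ t ∈ interior (Set.Icc (0:ℝ) 1), HasDerivWithinAt
      (fun t : ℝ => fderivWithin ℝ φ (cube d) (x + t • (y - x)) (y - x) - K * t)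
      (hessW φ (x + t • (y - x)) (y - x) (y - x) - K)
        (interior (Set.Icc (0:ℝ) 1)) t) := by
  have A : ∀ t ∈ Set.Icc (0:ℝ) 1, HasDerivWithinAt
      (fun t : ℝ => φ (x + t • (y - x)) - K / 2 * t ^ 2)
      (fderivWithin ℝ φ (cube d) (x + t • (y - x)) (y - x) - K * t) (Set.Icc (0:ℝ) 1) t := by
    intro t ht
    have h1 := line_deriv (hφ.differentiableOn (by norm_num)) hx hy ht
    have h2 : HasDerivWithinAt (fun t : ℝ => K / 2 * t ^ 2) (K * t) (Set.Icc (0:ℝ) 1) t := by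
      have := ((hasDerivAt_pow 2 t).const_mul (K / 2)).hasDerivWithinAt (s := Set.Icc (0:ℝ) 1)
      exact this.congr_deriv (by push_cast; ring)
    exact h1.sub h2
  refine ⟨fun t ht => (A t ht).continuousWithinAt,
    fun t ht => (A t (interior_subset ht)).mono interior_subset, fun t ht => ?_⟩
  have hd : DifferentiableOn ℝ (fun p => fderivWithin ℝ φ (cube d) p) (cube d) :=
    (hφ.fderivWithin (cube_unique d) (m := 1) (by norm_num)).differentiableOn (by norm_num)
  have h1 := line_deriv hd hx hy (interior_subset ht)
  have h3 := h1.clm_apply (hasDerivWithinAt_const t (Set.Icc (0:ℝ) 1) (y - x))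
  have h2 : HasDerivWithinAt (fun t : ℝ => K * t) K (Set.Icc (0:ℝ) 1) t := by
    simpa using ((hasDerivAt_id t).const_mul K).hasDerivWithinAt (s := Set.Icc (0:ℝ) 1)
  have h4 := (h3.sub h2).mono interior_subset
  refine HasDerivWithinAt.congr_deriv h4 ?_
  simp only [hessW, map_zero, add_zero]

lemma hess_eq {d : ℕ} (φ : E d → ℝ) {p : E d} (hp : p ∈ cube d) (a b : E d) :
    hessW φ p a b = iteratedFDerivWithin ℝ 2 φ (cube d) p ![a, b] :=
  (iteratedFDerivWithin_two_apply' φ (cube_unique d) hp a b).symm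

lemma line_convex {d : ℕ} {φ : E d → ℝ} (hφ : ContDiffOn ℝ 2 φ (cube d))
    {x y : E d} (hx : x ∈ cube d) (hy : y ∈ cube d) (K : ℝ)
    (h : ∀ t ∈ Set.Icc (0:ℝ) 1, K ≤ hessW φ (x + t • (y - x)) (y - x) (y - x)) :
    ConvexOn ℝ (Set.Icc (0:ℝ) 1) (fun t : ℝ => φ (x + t • (y - x)) - K / 2 * t ^ 2) := by
  obtain ⟨h1, h2, h3⟩ := line_data hφ hx hy K
  exact convexOn_of_hasDerivWithinAt2_nonneg (convex_Icc 0 1) h1 h2 h3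
    (fun t ht => sub_nonneg.2 (h t (interior_subset ht)))

lemma line_concave {d : ℕ} {φ : E d → ℝ} (hφ : ContDiffOn ℝ 2 φ (cube d))
    {x y : E d} (hx : x ∈ cube d) (hy : y ∈ cube d) (K : ℝ)
    (h : ∀ t ∈ Set.Icc (0:ℝ) 1, hessW φ (x + t • (y - x)) (y - x) (y - x) ≤ K) :
    ConcaveOn ℝ (Set.Icc (0:ℝ) 1) (fun t : ℝ => φ (x + t • (y - x)) - K / 2 * t ^ 2) := by
  obtain ⟨h1, h2, h3⟩ := line_data hφ hx hy K
  exact concaveOn_of_hasDerivWithinAt2_nonpos (convex_Icc 0 1) h1 h2 h3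
    (fun t ht => sub_nonpos.2 (h t (interior_subset ht)))

/-- failure of strong convexity gives a bad point and unit direction -/
lemma exists_bad {d : ℕ} {φ : E d → ℝ} (hφ : ContDiffOn ℝ 2 φ (cube d)) (κ : ℝ)
    (hc : ¬ ConvexOn ℝ (cube d) (fun x => φ x - (κ/2) * ‖x‖^2)) :
    ∃ z ∈ cube d, ∃ v : E d, ‖v‖ = 1 ∧ hessW φ z v v < κ := by
  by_contra! hcon
  apply hc
  have hcon' : ∀ z ∈ cube d, ∀ w : E d, κ * ‖w‖ ^ 2 ≤ hessW φ z w w := by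
    intro z hz w
    by_cases hw : w = 0
    · simp [hw]
    have hn : ‖w‖ ≠ 0 := norm_ne_zero_iff.2 hw
    have := hcon z hz (‖w‖⁻¹ • w) (by rw [norm_smul, norm_inv, norm_norm, inv_mul_cancel₀ hn])
    simp only [map_smul, smul_apply, smul_eq_mul] at this
    have h2 := mul_le_mul_of_nonneg_right this (sq_nonneg ‖w‖)
    have h3 : ‖w‖⁻¹ * (‖w‖⁻¹ * hessW φ z w w) * ‖w‖ ^ 2 = hessW φ z w w := by
      generalize hessW φ z w w = q
      field_simp
    rwa [h3] at h2
  refine ⟨cube_convex d, ?_⟩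
  intro x hx y hy a b ha hb hab
  have hL := line_convex hφ hx hy (κ * ‖y - x‖ ^ 2)
    (fun t ht => hcon' _ (line_mem hx hy ht) _)
  have h := hL.2 (x := 0) (by simp) (y := 1) (by simp) ha hb hab
  have ha' : a = 1 - b := by linarith
  have e : a • x + b • y = x + b • (y - x) := by
    rw [ha']; module
  simp only [smul_eq_mul, mul_zero, mul_one, zero_add, zero_smul, one_smul, add_zero,
    add_sub_cancel] at h ⊢
  rw [e]
  have e1 : ‖x + b • (y - x)‖ ^ 2 = ‖x‖ ^ 2 + 2 * (b * inner ℝ x (y - x)) + b ^ 2 * ‖y - x‖ ^ 2 := by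
    rw [norm_add_sq_real, inner_smul_right, norm_smul, mul_pow, Real.norm_eq_abs, sq_abs]
  have e2 : ‖y‖ ^ 2 = ‖x‖ ^ 2 + 2 * inner ℝ x (y - x) + ‖y - x‖ ^ 2 := by
    rw [← norm_add_sq_real, add_sub_cancel]
  rw [e1, e2]
  subst ha'
  nlinarith [h]

lemma hess_bound {d : ℕ} {φ : E d → ℝ} {H : ℝ} (hφ : ContDiffOn ℝ 2 φ (cube d))
    (hn : C21norm φ ≤ H) {p : E d} (hp : p ∈ cube d) (a b : E d) :
    |hessW φ p a b| ≤ H * ‖a‖ * ‖b‖ := by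
  have hB : ‖iteratedFDerivWithin ℝ 2 φ (cube d) p‖ ≤ H := by
    have h1 : C2norm φ ≤ H := by
      have : 0 ≤ ⨆ p : cube d × cube d,
        ‖iteratedFDerivWithin ℝ 2 φ (cube d) (p.1 : E d) -
          iteratedFDerivWithin ℝ 2 φ (cube d) (p.2 : E d)‖
          / ‖(p.1 : E d) - (p.2 : E d)‖ := Real.iSup_nonneg (fun _ => by positivity)
      unfold C21norm at hn
      linarith
    refine le_trans ?_ h1
    have hc : ContinuousOn (fun x => ‖iteratedFDerivWithin ℝ 2 φ (cube d) x‖) (cube d) :=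
      (hφ.continuousOn_iteratedFDerivWithin (m := 2) le_rfl (cube_unique d)).norm
    have hb := (cube_compact d).bddAbove_image hc
    have h2 : ‖iteratedFDerivWithin ℝ 2 φ (cube d) p‖ ≤
        ⨆ x : cube d, ‖iteratedFDerivWithin ℝ 2 φ (cube d) (x : E d)‖ := by
      refine le_ciSup (f := fun x : cube d => ‖iteratedFDerivWithin ℝ 2 φ (cube d) (x : E d)‖)
        ?_ ⟨p, hp⟩
      obtain ⟨M, hM⟩ := hb
      refine ⟨M, ?_⟩
      rintro _ ⟨x, rfl⟩
      exact hM ⟨x, x.2, rfl⟩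
    exact h2.trans (le_ciSup (f := fun k : Fin 3 =>
      ⨆ x : cube d, ‖iteratedFDerivWithin ℝ (k : ℕ) φ (cube d) (x : E d)‖)
      (Set.finite_range _).bddAbove (2 : Fin 3))
  rw [hess_eq φ hp]
  have := (iteratedFDerivWithin ℝ 2 φ (cube d) p).le_of_opNorm_le hB ![a, b]
  simpa [Fin.prod_univ_two, mul_assoc] using this

lemma hess_lip {d : ℕ} {φ : E d → ℝ} {H : ℝ} (hH : 0 < H)
    (hl : LipschitzOnWith (Real.toNNReal H)
          (fun x => iteratedFDerivWithin ℝ 2 φ (cube d) x) (cube d))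
    {p z : E d} (hp : p ∈ cube d) (hz : z ∈ cube d) (a : E d) :
    hessW φ p a a ≤ hessW φ z a a + H * ‖p - z‖ * ‖a‖ ^ 2 := by
  have h := hl.dist_le_mul p hp z hz
  rw [dist_eq_norm, dist_eq_norm, Real.coe_toNNReal _ hH.le] at h
  have := (iteratedFDerivWithin ℝ 2 φ (cube d) p -
    iteratedFDerivWithin ℝ 2 φ (cube d) z).le_of_opNorm_le h ![a, a]
  rw [hess_eq φ hp, hess_eq φ hz]
  have h2 := (le_abs_self _).trans this
  simp only [sub_apply, Fin.prod_univ_two, Matrix.cons_val_zero,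
    Matrix.cons_val_one] at h2
  nlinarith

lemma scalar_aux {H κ η R δ : ℝ} (hH : 0 < H) (hη : 0 < η) (hδ : 0 < δ)
    (hδδ : δ ^ 2 ≤ δ / 4) (hδ2 : δ * (H * (R + 1) + 3 * H + 2 * κ) ≤ η / 2) :
    κ - η + H * (δ * (R + 1)) + 2 * δ * H + δ ^ 2 * H ≤ (κ - η / 2) * (1 - 2 * δ) := by
  have b1 : δ ^ 2 * H ≤ δ * H := by
    apply mul_le_mul_of_nonneg_right _ hH.le
    linarith
  have b2 := mul_pos hη hδ
  linarith

set_option maxHeartbeats 1000000 in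
/-- pointwise lower bound for the integrand -/
lemma pointwise {d : ℕ} {φ : E d → ℝ} {H κ η R δ : ℝ} (hH : 0 < H)
    (hφ : ContDiffOn ℝ 2 φ (cube d)) (hn : C21norm φ ≤ H)
    (hl : LipschitzOnWith (Real.toNNReal H)
          (fun x => iteratedFDerivWithin ℝ 2 φ (cube d) x) (cube d))
    (hη : 0 < η) (hηκ : η < κ) (hR : ∀ z ∈ cube d, ‖cubeC d - z‖ ≤ R)
    (hδ : 0 < δ) (hδ1 : δ ≤ 1/4) (hδ2 : δ * (H * (R + 1) + 3 * H + 2 * κ) ≤ η / 2)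
    {z v : E d} (hz : z ∈ cube d) (hv : ‖v‖ = 1) (hzv : hessW φ z v v < κ - η)
    {u u' : E d}
    (hu : ‖u - (z + δ • (cubeC d - z) + (δ/4) • v)‖ ≤ δ ^ 2 / 4)
    (hu' : ‖u' - (z + δ • (cubeC d - z) - (δ/4) • v)‖ ≤ δ ^ 2 / 4) :
    u ∈ cube d ∧ u' ∈ cube d ∧ η * δ ^ 2 / 128 ≤
      φ ((2:ℝ)⁻¹ • (u + u')) - (φ u + φ u')/2 + (κ/8) * ‖u - u'‖^2 := by
  set m := z + δ • (cubeC d - z) with hm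
  have hδδ : δ ^ 2 ≤ δ / 4 := by nlinarith
  have hτv : ‖(δ/4) • v‖ = δ / 4 := by
    rw [norm_smul, hv, Real.norm_eq_abs, abs_of_pos (by positivity), mul_one]
  have hum : ‖u - m‖ ≤ δ / 2 := by
    have : u - m = (u - (m + (δ/4) • v)) + (δ/4) • v := by abel
    rw [this]
    refine (norm_add_le _ _).trans ?_
    linarith
  have hum' : ‖u' - m‖ ≤ δ / 2 := by
    have : u' - m = (u' - (m - (δ/4) • v)) - (δ/4) • v := by abel
    rw [this]
    refine (norm_sub_le _ _).trans ?_
    linarith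
  have huc : u ∈ cube d := cube_ball hz (by linarith) hum
  have huc' : u' ∈ cube d := cube_ball hz (by linarith) hum'
  refine ⟨huc, huc', ?_⟩
  obtain ⟨e, he⟩ : ∃ e, e = (u - u') - (δ/2) • v := ⟨_, rfl⟩
  have hwe : u - u' = (δ/2) • v + e := by rw [he]; abel
  have hen : ‖e‖ ≤ δ ^ 2 / 2 := by
    have : e = (u - (m + (δ/4) • v)) - (u' - (m - (δ/4) • v)) := by
      rw [he]; module
    rw [this]
    refine (norm_sub_le _ _).trans ?_
    linarith
  have hwn : δ / 2 - δ ^ 2 / 2 ≤ ‖u - u'‖ := by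
    have h1 : ‖(δ/2) • v‖ = δ / 2 := by
      rw [norm_smul, hv, Real.norm_eq_abs, abs_of_pos (by positivity), mul_one]
    have h2 : (δ/2) • v = (u - u') - e := by rw [hwe]; abel
    have h3 := norm_sub_le (u - u') e
    rw [← h2, h1] at h3
    linarith
  have hwn2 : δ ^ 2 / 4 * (1 - 2 * δ) ≤ ‖u - u'‖ ^ 2 := by
    have h0 : 0 ≤ δ / 2 - δ ^ 2 / 2 := by nlinarith
    have := pow_le_pow_left₀ h0 hwn 2
    nlinarith [sq_nonneg (δ^2)]
  have hK : ∀ t ∈ Set.Icc (0:ℝ) 1, hessW φ (u' + t • (u - u')) (u - u') (u - u')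
      ≤ (κ - η / 2) * ‖u - u'‖ ^ 2 := by
    intro t ht
    have hp := line_mem huc' huc ht
    have hpm : ‖u' + t • (u - u') - m‖ ≤ δ / 2 := by
      have := (convex_closedBall m (δ/2)).add_smul_sub_mem (x := u') (y := u)
        (by rwa [Metric.mem_closedBall, dist_eq_norm])
        (by rwa [Metric.mem_closedBall, dist_eq_norm]) ht
      rwa [Metric.mem_closedBall, dist_eq_norm] at this
    set p := u' + t • (u - u') with hpdef
    have hpz : ‖p - z‖ ≤ δ * (R + 1) := by
      have e1 : p - z = (p - m) + δ • (cubeC d - z) := by rw [hm]; abel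
      rw [e1]
      refine (norm_add_le _ _).trans ?_
      rw [norm_smul, Real.norm_eq_abs, abs_of_pos hδ]
      nlinarith [hR z hz]
    have h1 : hessW φ p v v ≤ κ - η + H * (δ * (R + 1)) := by
      have := hess_lip hH hl hp hz v
      rw [hv] at this
      nlinarith
    have h2 : hessW φ p v e ≤ H * (δ ^ 2 / 2) := by
      have := (le_abs_self _).trans (hess_bound hφ hn hp v e)
      rw [hv] at this
      nlinarith
    have h3 : hessW φ p e v ≤ H * (δ ^ 2 / 2) := by
      have := (le_abs_self _).trans (hess_bound hφ hn hp e v)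
      rw [hv] at this
      nlinarith
    have h4 : hessW φ p e e ≤ H * (δ ^ 2 / 2) ^ 2 := by
      have := (le_abs_self _).trans (hess_bound hφ hn hp e e)
      have h5 := pow_le_pow_left₀ (norm_nonneg e) hen 2
      nlinarith
    have h6 : hessW φ p (u - u') (u - u') = (δ/2)^2 * hessW φ p v v
        + (δ/2) * hessW φ p v e + (δ/2) * hessW φ p e v + hessW φ p e e := by
      rw [hwe]
      simp only [map_add, map_smul, add_apply,
        smul_apply, smul_eq_mul]
      ring
    have h7 : hessW φ p (u - u') (u - u') ≤
        δ ^ 2 / 4 * (κ - η + H * (δ * (R + 1)) + 2 * δ * H + δ ^ 2 * H) := by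
      rw [h6]
      have a1 := mul_le_mul_of_nonneg_left h1 (sq_nonneg (δ/2))
      have a2 := mul_le_mul_of_nonneg_left h2 (by positivity : 0 ≤ δ/2)
      have a3 := mul_le_mul_of_nonneg_left h3 (by positivity : 0 ≤ δ/2)
      linarith
    have h8 : (κ - η / 2) * (δ ^ 2 / 4 * (1 - 2 * δ)) ≤ (κ - η / 2) * ‖u - u'‖ ^ 2 :=
      mul_le_mul_of_nonneg_left hwn2 (by linarith)
    refine h7.trans (le_trans ?_ h8)
    have h9 : κ - η + H * (δ * (R + 1)) + 2 * δ * H + δ ^ 2 * H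
        ≤ (κ - η / 2) * (1 - 2 * δ) := scalar_aux hH hη hδ hδδ hδ2
    have := mul_le_mul_of_nonneg_left h9 (by positivity : 0 ≤ δ ^ 2 / 4)
    linarith
  have hL := line_concave hφ huc' huc _ hK
  have hh : (0:ℝ) ≤ 1/2 := by norm_num
  have hh1 : (1/2:ℝ) + 1/2 = 1 := by norm_num
  have h := hL.2 (x := 0) (by simp) (y := 1) (by simp) hh hh hh1
  have e2 : u' + (1/2 : ℝ) • (u - u') = (2:ℝ)⁻¹ • (u + u') := by module
  simp only [smul_eq_mul, mul_zero, mul_one, zero_add, zero_smul, one_smul, add_zero,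
    add_sub_cancel] at h
  rw [e2] at h
  have hf : η * (δ ^ 2 / 4 * (1 / 2)) ≤ η * ‖u - u'‖ ^ 2 := by
    refine mul_le_mul_of_nonneg_left (le_trans ?_ hwn2) hη.le
    exact mul_le_mul_of_nonneg_left (by linarith) (by positivity)
  linarith

/-- functions in a `C^{2,1}`-ball of radius `H̃` that fail to be
`(β/2−η)`-strongly convex on the cube have convexity penalty `P^{(β/2)}` bounded
below by a `ζ > 0` depending only on `d`, `β`, `η` and `H̃`. -/
theorem stmt8 (d : ℕ) (Htilde β η : ℝ) (hH : 0 < Htilde) (hβ : 0 < β)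
    (hη : 0 < η) (hηβ : η < β/2) :
    ∃ ζ : ℝ, 0 < ζ ∧
      ∀ φ : E d → ℝ,
        ContDiffOn ℝ 2 φ (cube d) →
        C21norm φ ≤ Htilde →
        LipschitzOnWith (Real.toNNReal Htilde)
          (fun x => iteratedFDerivWithin ℝ 2 φ (cube d) x) (cube d) →
        ¬ ConvexOn ℝ (cube d) (fun x => φ x - ((β/2 - η)/2) * ‖x‖^2) →
        ζ ≤ Pen (β/2) φ := by
  have hbd : ∃ R : ℝ, ∀ z ∈ cube d, ‖cubeC d - z‖ ≤ R := by
    obtain ⟨R, hR⟩ := (cube_compact d).isBounded.subset_closedBall (cubeC d)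
    refine ⟨R, fun z hz => ?_⟩
    have := hR hz
    rwa [Metric.mem_closedBall, dist_comm, dist_eq_norm] at this
  obtain ⟨R, hR⟩ := hbd
  have hR0 : 0 ≤ R := (norm_nonneg _).trans (hR _ (cubeC_mem d))
  set A := Htilde * (R + 1) + 3 * Htilde + 2 * (β/2) with hA
  have hA0 : 0 < A := by positivity
  obtain ⟨δ, hδ, hδ1, hδ2⟩ : ∃ δ : ℝ, 0 < δ ∧ δ ≤ 1/4 ∧ δ * A ≤ η / 2 := by
    refine ⟨min (1/4) (η / 2 / A), by positivity, min_le_left _ _, ?_⟩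
    calc _ ≤ (η / 2 / A) * A := mul_le_mul_of_nonneg_right (min_le_right _ _) hA0.le
      _ = η / 2 := by field_simp
  set V : ℝ := (volume (Metric.closedBall (0 : E d) (δ ^ 2 / 4))).toReal with hV
  have hV0 : 0 < V := ENNReal.toReal_pos
    (Metric.measure_closedBall_pos volume _ (by positivity)).ne' measure_closedBall_lt_top.ne
  refine ⟨η * δ ^ 2 / 128 * (V * V), by positivity, ?_⟩
  intro φ hφ hn hl hc
  obtain ⟨z, hz, v, hv, hzv⟩ := exists_bad hφ _ hc
  have hpt := fun u u' => pointwise (u := u) (u' := u') hH hφ hn hl hη hηβ hR hδ hδ1 hδ2 hz hv hzv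
  set S : Set (E d × E d) :=
    Metric.closedBall (z + δ • (cubeC d - z) + (δ/4) • v) (δ ^ 2 / 4) ×ˢ
    Metric.closedBall (z + δ • (cubeC d - z) - (δ/4) • v) (δ ^ 2 / 4) with hS
  have hSm : MeasurableSet S := Metric.isClosed_closedBall.measurableSet.prod
    Metric.isClosed_closedBall.measurableSet
  have hSp : ∀ q ∈ S, q.1 ∈ cube d ∧ q.2 ∈ cube d ∧ η * δ ^ 2 / 128 ≤
      φ ((2:ℝ)⁻¹ • (q.1 + q.2)) - (φ q.1 + φ q.2)/2 + ((β/2)/8) * ‖q.1 - q.2‖^2 := by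
    rintro ⟨u, u'⟩ ⟨h1, h2⟩
    rw [Metric.mem_closedBall, dist_eq_norm] at h1 h2
    exact hpt u u' h1 h2
  have hSV : ((volume : Measure (E d)).prod (volume : Measure (E d))).real S = V * V := by
    rw [hS, Measure.real, Measure.prod_prod, ENNReal.toReal_mul,
      Measure.addHaar_closedBall_center, Measure.addHaar_closedBall_center _ (z + _ - _)]
  have hSc : S ⊆ cube d ×ˢ cube d := fun q hq => ⟨(hSp q hq).1, (hSp q hq).2.1⟩
  unfold Pen
  rw [Measure.prod_restrict]
  have hcont : ContinuousOn (fun u : E d × E d => max 0 (φ ((2:ℝ)⁻¹ • (u.1 + u.2))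
      - (φ u.1 + φ u.2)/2 + ((β/2)/8) * ‖u.1 - u.2‖^2)) (cube d ×ˢ cube d) := by
    have c0 := hφ.continuousOn
    have c1 : ContinuousOn (fun u : E d × E d => φ u.1) (cube d ×ˢ cube d) :=
      c0.comp continuousOn_fst (fun u hu => hu.1)
    have c2 : ContinuousOn (fun u : E d × E d => φ u.2) (cube d ×ˢ cube d) :=
      c0.comp continuousOn_snd (fun u hu => hu.2)
    have c3 : ContinuousOn (fun u : E d × E d => φ ((2:ℝ)⁻¹ • (u.1 + u.2)))
        (cube d ×ˢ cube d) := by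
      refine c0.comp (by fun_prop) (fun u hu => ?_)
      have := cube_convex d hu.1 hu.2 (a := (2:ℝ)⁻¹) (b := (2:ℝ)⁻¹) (by norm_num) (by norm_num)
        (by norm_num)
      simpa [smul_add] using this
    have c4 : ContinuousOn (fun u : E d × E d => ((β/2)/8) * ‖u.1 - u.2‖^2)
        (cube d ×ˢ cube d) := by fun_prop
    exact ContinuousOn.sup continuousOn_const ((c3.sub ((c1.add c2).div_const 2)).add c4)
  have hint := hcont.integrableOn_compact (μ := (volume : Measure (E d)).prod volume)
    ((cube_compact d).prod (cube_compact d))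
  have h1 := setIntegral_mono_set hint (s := S)
    (Filter.Eventually.of_forall (fun q => le_max_left _ _)) (LE.le.eventuallyLE hSc)
  refine le_trans ?_ h1
  rw [← hSV]
  refine setIntegral_ge_of_const_le_real hSm ?_ ?_ (hint.mono_set hSc)
  · exact (lt_of_le_of_lt (measure_mono hSc)
      ((cube_compact d).prod (cube_compact d)).measure_lt_top).ne
  · intro q hq
    exact (hSp q hq).2.2.trans (le_max_right _ _)

end
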